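/- Let σ_D, σ_E > 0, let σ_DE² = 1/(1/σ_D² + 1/σ_E²), and for A > 0 set β(A) = ln(1 + 2A/σ_E). Define L(A) = (1/2) ln(1 + (2A²/σ_DE²)/(πe)) − (1 − 2Q(β(A) + A/σ_E)) · ln( 2(β(A) + A/σ_E) / (√(2π)(1 − 2Q(β(A)))) ) − Q(β(A)) − (β(A)/√(2π)) e^{−β(A)²/2} + 1/2. Then lim_{A → ∞} L(A) = (1/2) ln(1 + σ_E²/σ_D²). -/

import Mathlib

open MeasureTheory ProbabilityTheory Real Filter Set
open scoped Classical

noncomputable section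

/-- The Gaussian Q-function `Q(x) = (1/√(2π)) ∫_x^∞ exp(−u²/2) du`. -/
def Qfun (x : ℝ) : ℝ := (Real.sqrt (2 * π))⁻¹ * ∫ u in Set.Ioi x, Real.exp (-u ^ 2 / 2)

lemma Qfun_nonneg (x : ℝ) : 0 ≤ Qfun x :=
  mul_nonneg (by positivity) (integral_nonneg fun u => (Real.exp_pos _).le)

lemma integrable_exp_neg_sq_div_two : Integrable fun u : ℝ => Real.exp (-u ^ 2 / 2) := by
  refine (integrable_exp_neg_mul_sq (b := 1 / 2) (by norm_num)).congr (.of_forall fun u => ?_)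
  ring_nf

lemma integrable_mul_exp_neg_sq_div_two :
    Integrable fun u : ℝ => u * Real.exp (-u ^ 2 / 2) := by
  refine (integrable_mul_exp_neg_mul_sq (b := 1 / 2) (by norm_num)).congr (.of_forall fun u => ?_)
  ring_nf

lemma tendsto_setIntegral_Ioi_zero {f : ℝ → ℝ} (hf : Integrable f) :
    Tendsto (fun x => ∫ u in Set.Ioi x, f u) atTop (nhds 0) := by
  have h := tendsto_setIntegral_of_antitone (f := f) (s := fun x : ℝ => Set.Ioi x)
    (fun _ => measurableSet_Ioi) (fun _ _ h => Set.Ioi_subset_Ioi h) ⟨0, hf.integrableOn⟩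
  have h0 : (⋂ n : ℝ, Set.Ioi n) = ∅ := by
    ext y
    simpa using ⟨y, le_refl y⟩
  simpa [h0] using h

lemma tendsto_Qfun_atTop : Tendsto Qfun atTop (nhds 0) := by
  have h := (tendsto_setIntegral_Ioi_zero integrable_exp_neg_sq_div_two).const_mul
    (Real.sqrt (2 * π))⁻¹
  rwa [mul_zero] at h

lemma tendsto_Qfun_mul_self_atTop : Tendsto (fun x => Qfun x * x) atTop (nhds 0) := by
  have h := (tendsto_setIntegral_Ioi_zero integrable_mul_exp_neg_sq_div_two).const_mul
    (Real.sqrt (2 * π))⁻¹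
  rw [mul_zero] at h
  refine squeeze_zero' ?_ ?_ h
  · filter_upwards [eventually_ge_atTop 0] with x hx using mul_nonneg (Qfun_nonneg x) hx
  · filter_upwards with x
    rw [Qfun, mul_assoc, mul_comm _ x, ← integral_const_mul]
    refine mul_le_mul_of_nonneg_left (setIntegral_mono_on
      (integrable_exp_neg_sq_div_two.const_mul x).integrableOn
      integrable_mul_exp_neg_sq_div_two.integrableOn measurableSet_Ioi fun u hu => ?_)
      (by positivity)
    exact mul_le_mul_of_nonneg_right (le_of_lt hu) (Real.exp_pos _).le

lemma tendsto_Qfun_mul_log_atTop :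
    Tendsto (fun x => Qfun x * Real.log x) atTop (nhds 0) := by
  refine squeeze_zero' ?_ ?_ tendsto_Qfun_mul_self_atTop
  · filter_upwards [eventually_ge_atTop 1] with x hx
    exact mul_nonneg (Qfun_nonneg x) (Real.log_nonneg hx)
  · filter_upwards [eventually_ge_atTop 0] with x hx
    exact mul_le_mul_of_nonneg_left (Real.log_le_self hx) (Qfun_nonneg x)

lemma tendsto_mul_exp_neg_sq_div_two_atTop :
    Tendsto (fun x : ℝ => x * Real.exp (-x ^ 2 / 2)) atTop (nhds 0) := by
  have h := Real.tendsto_pow_mul_exp_neg_atTop_nhds_zero 1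
  refine squeeze_zero' ?_ ?_ h
  · filter_upwards [eventually_ge_atTop 0] with x hx
    positivity
  · filter_upwards [eventually_ge_atTop 2] with x hx
    rw [pow_one]
    gcongr
    nlinarith

lemma tendsto_log_one_add_mul_div_atTop {a : ℝ} (ha : 0 < a) :
    Tendsto (fun x : ℝ => Real.log (1 + a * x) / x) atTop (nhds 0) := by
  have ht : Tendsto (fun x : ℝ => 1 + a * x) atTop atTop :=
    tendsto_atTop_add_const_left _ _ (tendsto_id.const_mul_atTop ha)
  have h1 : Tendsto (fun x : ℝ => Real.log (1 + a * x) / (1 + a * x)) atTop (nhds 0) :=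
    Real.isLittleO_log_id_atTop.tendsto_div_nhds_zero.comp ht
  have h2 : Tendsto (fun x : ℝ => x⁻¹ + a) atTop (nhds (0 + a)) :=
    tendsto_inv_atTop_zero.add_const a
  have h := h1.mul h2
  rw [zero_mul] at h
  refine h.congr' ?_
  filter_upwards [eventually_gt_atTop 0] with x hx
  have : 1 + a * x ≠ 0 := by positivity
  field_simp

/-- If `y x / x → r > 0`, then `log (1 + c x²) / 2 - log (y x) → log (c / r²) / 2`. -/
lemma tendsto_half_log_one_add_mul_sq_sub_log {c r : ℝ} (hc : 0 < c) (hr : 0 < r) {y : ℝ → ℝ}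
    (hy : Tendsto (fun x => y x / x) atTop (nhds r)) :
    Tendsto (fun x => 1 / 2 * Real.log (1 + c * x ^ 2) - Real.log (y x)) atTop
      (nhds (1 / 2 * Real.log (c / r ^ 2))) := by
  have h1 : Tendsto (fun x : ℝ => (x⁻¹ ^ 2 + c) / (y x / x) ^ 2) atTop
      (nhds ((0 ^ 2 + c) / r ^ 2)) :=
    ((tendsto_inv_atTop_zero.pow 2).add_const c).div (hy.pow 2) (by positivity)
  rw [zero_pow two_ne_zero, zero_add] at h1
  refine ((h1.log (by positivity)).const_mul (1 / 2)).congr' ?_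
  filter_upwards [eventually_gt_atTop 0, hy.eventually_const_lt hr] with x hx hyx
  have hyp : 0 < y x := by
    have := mul_pos hyx hx
    rwa [div_mul_cancel₀ _ hx.ne'] at this
  have : (x⁻¹ ^ 2 + c) / (y x / x) ^ 2 = (1 + c * x ^ 2) / y x ^ 2 := by
    field_simp
  rw [this, Real.log_div (by positivity) (by positivity), Real.log_pow]
  push_cast
  ring

/-- With `β(A) = ln(1 + 2A/σ_E)`, the lower bound `L(A)` converges to
`(1/2) ln(1 + σ_E²/σ_D²)` as `A → ∞`. -/
theorem stmt18 (σD σE : ℝ) (hσD : 0 < σD) (hσE : 0 < σE) :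
    Tendsto (fun A : ℝ =>
        1 / 2 * Real.log (1 + 2 * A ^ 2 / (1 / (1 / σD ^ 2 + 1 / σE ^ 2)) / (π * Real.exp 1))
        - (1 - 2 * Qfun (Real.log (1 + 2 * A / σE) + A / σE)) *
            Real.log (2 * (Real.log (1 + 2 * A / σE) + A / σE) /
              (Real.sqrt (2 * π) * (1 - 2 * Qfun (Real.log (1 + 2 * A / σE)))))
        - Qfun (Real.log (1 + 2 * A / σE))
        - Real.log (1 + 2 * A / σE) / Real.sqrt (2 * π) *
            Real.exp (-Real.log (1 + 2 * A / σE) ^ 2 / 2)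
        + 1 / 2)
      atTop (nhds (1 / 2 * Real.log (1 + σE ^ 2 / σD ^ 2))) := by
  have hβ : Tendsto (fun A : ℝ => Real.log (1 + 2 * A / σE)) atTop atTop := by
    refine Real.tendsto_log_atTop.comp (tendsto_atTop_add_const_left _ _ ?_)
    exact (tendsto_id.const_mul_atTop two_pos).atTop_div_const hσE
  have hx : Tendsto (fun A : ℝ => Real.log (1 + 2 * A / σE) + A / σE) atTop atTop :=
    hβ.atTop_add_atTop (tendsto_id.atTop_div_const hσE)
  have hxA : Tendsto (fun A : ℝ => (Real.log (1 + 2 * A / σE) + A / σE) / A) atTop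
      (nhds σE⁻¹) := by
    have h := (tendsto_log_one_add_mul_div_atTop (a := 2 / σE) (by positivity)).add_const σE⁻¹
    rw [zero_add] at h
    refine h.congr' ?_
    filter_upwards [eventually_gt_atTop 0] with A hA
    rw [add_div, div_mul_eq_mul_div, div_div_cancel_left' hA.ne']
  set c : ℝ := 2 * (1 / σD ^ 2 + 1 / σE ^ 2) / (π * Real.exp 1) with hc
  have hc0 : 0 < c := by positivity
  have hmain := tendsto_half_log_one_add_mul_sq_sub_log hc0 (inv_pos.2 hσE) hxA
  have hQβ := tendsto_Qfun_atTop.comp hβ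
  have hQx := tendsto_Qfun_atTop.comp hx
  have hQlog := tendsto_Qfun_mul_log_atTop.comp hx
  have hexp := (tendsto_mul_exp_neg_sq_div_two_atTop.comp hβ).div_const (Real.sqrt (2 * π))
  have hlogQ : Tendsto (fun A : ℝ => Real.log (1 - 2 * Qfun (Real.log (1 + 2 * A / σE)))) atTop
      (nhds 0) := by
    have h := ((hQβ.const_mul 2).const_sub 1).log (by norm_num)
    simpa using h
  set k : ℝ := Real.log (2 / Real.sqrt (2 * π)) with hk
  have hsum := (((((hmain.sub_const k).add hlogQ).add (hQlog.const_mul 2)).add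
    ((hQx.const_mul 2).mul (hlogQ.const_sub k))).sub hQβ).sub hexp |>.add_const (1 / 2)
  have hlim : 1 / 2 * Real.log (c / σE⁻¹ ^ 2) - k + 0 + 2 * 0 + 2 * 0 * (k - 0) - 0
      - 0 / Real.sqrt (2 * π) + 1 / 2 = 1 / 2 * Real.log (1 + σE ^ 2 / σD ^ 2) := by
    have h1 : c / σE⁻¹ ^ 2 = (1 + σE ^ 2 / σD ^ 2) * (2 / π) / Real.exp 1 := by
      rw [hc]
      field_simp
      ring
    have h2 : k = 1 / 2 * Real.log (2 / π) := by
      have : 2 / π = (2 / Real.sqrt (2 * π)) ^ 2 := by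
        rw [div_pow, Real.sq_sqrt (by positivity)]
        field_simp
      rw [this, Real.log_pow, hk]
      push_cast
      ring
    rw [h1, h2, Real.log_div (by positivity) (by positivity),
      Real.log_mul (by positivity) (by positivity), Real.log_exp]
    ring
  rw [hlim] at hsum
  refine hsum.congr' ?_
  filter_upwards [hx.eventually_gt_atTop 0, hQβ.eventually_lt_const (by norm_num : (0 : ℝ) < 1 / 2)]
    with A hA hq
  simp only [Function.comp_apply] at hq ⊢
  have hq' : 0 < 1 - 2 * Qfun (Real.log (1 + 2 * A / σE)) := by linarith
  have hP : 2 * A ^ 2 / (1 / (1 / σD ^ 2 + 1 / σE ^ 2)) / (π * Real.exp 1) = c * A ^ 2 := by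
    rw [hc, div_div_eq_mul_div, div_one]
    ring
  have hT : Real.log (2 * (Real.log (1 + 2 * A / σE) + A / σE) /
      (Real.sqrt (2 * π) * (1 - 2 * Qfun (Real.log (1 + 2 * A / σE))))) =
      k + Real.log (Real.log (1 + 2 * A / σE) + A / σE) -
        Real.log (1 - 2 * Qfun (Real.log (1 + 2 * A / σE))) := by
    rw [mul_div_mul_comm, Real.log_mul (by positivity) (by positivity),
      Real.log_div hA.ne' hq'.ne', add_sub_assoc]
  rw [hP, hT]
  ring

end
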